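/- arXiv:2108.10260 — 3 statements merged into one kernel-verified Lean document; each statement's English description precedes it below -/
import Mathlib

section
/- Let f : ℝ^n → ℝ be continuously differentiable, μ-strongly convex and λ-smooth with 0 ≤ μ ≤ λ. Let D ⊆ ℝ^n be a nonempty closed convex set, K ⊆ ℝ^m a nonempty closed convex cone with polar cone K°, H ∈ ℝ^{m×n}, g ∈ ℝ^m, and let σ ≥ ‖H‖², where ‖H‖ is the largest singular value of H. Let α, β > 0 satisfy α(λ + σβ) = 1. Given z⁰ ∈ D and v⁰ ∈ ℝ^m, define w⁺ = π_{K°}[v⁰ + β(Hz⁰ − g)], z⁺ = π_D[z⁰ − α(∇f(z⁰) + Hᵀ w⁺)], and v⁺ = w⁺ + β H(z⁺ − z⁰). Then for all z ∈ D and all w ∈ K°: β·d_K(Hz⁰ − g) + L(z⁺, w) − L(z, w⁺) ≤ (1/(2α) − μ/2)‖z⁰ − z‖² + (1/(2β))‖v⁰ − w‖² − (1/(2α))‖z⁺ − z‖² − (1/(2β))‖v⁺ − w‖². -/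
open RealInnerProductSpace

/-- Euclidean (metric) projection onto a set `S`: the nearest point of `S` when it exists. -/
noncomputable def metricProj {E : Type*} [NormedAddCommGroup E] [InnerProductSpace ℝ E]
    (S : Set E) (x : E) : E := by
  classical exact if h : ∃ y, y ∈ S ∧ ∀ u ∈ S, ‖x - y‖ ≤ ‖x - u‖ then h.choose else x

/-- Polar cone `K° = {w : ⟪w, y⟫ ≤ 0 for all y ∈ K}`. -/
def polarCone {E : Type*} [NormedAddCommGroup E] [InnerProductSpace ℝ E] (K : Set E) : Set E :=
  {w | ∀ y ∈ K, ⟪w, y⟫ ≤ 0}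

/-- Quadratic distance function `d_K(w) = min_{v ∈ K} (1/2)‖w - v‖²`. -/
noncomputable def coneDist {E : Type*} [NormedAddCommGroup E] [InnerProductSpace ℝ E]
    (K : Set E) (w : E) : ℝ := (1/2) * (Metric.infDist w K)^2

theorem metricProj_spec {E : Type*} [NormedAddCommGroup E] [InnerProductSpace ℝ E]
    [CompleteSpace E] {S : Set E} (hne : S.Nonempty) (hcl : IsClosed S) (hconv : Convex ℝ S)
    (x : E) :
    metricProj S x ∈ S ∧ ∀ u ∈ S, ⟪x - metricProj S x, u - metricProj S x⟫ ≤ 0 := by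
  have bdd : BddBelow (Set.range fun w : S => ‖x - w‖) :=
    ⟨0, by rintro _ ⟨w, rfl⟩; exact norm_nonneg _⟩
  have hex : ∃ y, y ∈ S ∧ ∀ u ∈ S, ‖x - y‖ ≤ ‖x - u‖ := by
    obtain ⟨y, hy, hmin⟩ := exists_norm_eq_iInf_of_complete_convex hne hcl.isComplete hconv x
    exact ⟨y, hy, fun u hu => hmin ▸ ciInf_le bdd ⟨u, hu⟩⟩
  have hproj : metricProj S x = hex.choose := by
    unfold metricProj
    exact dif_pos hex
  obtain ⟨hmem, hmin⟩ := hex.choose_spec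
  rw [← hproj] at hmem hmin
  refine ⟨hmem, (norm_eq_iInf_iff_real_inner_le_zero hconv hmem).1 ?_⟩
  have : Nonempty S := hne.to_subtype
  exact le_antisymm (le_ciInf fun u => hmin u u.2) (ciInf_le bdd ⟨_, hmem⟩)

theorem isClosed_polarCone {E : Type*} [NormedAddCommGroup E] [InnerProductSpace ℝ E]
    (K : Set E) : IsClosed (polarCone K) := by
  have : polarCone K = ⋂ y ∈ K, {w : E | ⟪w, y⟫ ≤ 0} := by
    ext w
    simp [polarCone]
  rw [this]
  exact isClosed_biInter fun y _ =>
    isClosed_le (continuous_id.inner continuous_const) continuous_const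

theorem convex_polarCone {E : Type*} [NormedAddCommGroup E] [InnerProductSpace ℝ E]
    (K : Set E) : Convex ℝ (polarCone K) := by
  intro a ha b hb s t hs ht _ y hy
  rw [inner_add_left, real_inner_smul_left, real_inner_smul_left]
  nlinarith [mul_nonneg hs (neg_nonneg.2 (ha y hy)), mul_nonneg ht (neg_nonneg.2 (hb y hy))]

theorem zero_mem_polarCone {E : Type*} [NormedAddCommGroup E] [InnerProductSpace ℝ E]
    (K : Set E) : (0 : E) ∈ polarCone K := fun y _ => by simp

theorem smul_mem_polarCone {E : Type*} [NormedAddCommGroup E] [InnerProductSpace ℝ E]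
    {K : Set E} {c : ℝ} (hc : 0 ≤ c) {w : E} (hw : w ∈ polarCone K) : c • w ∈ polarCone K := by
  intro y hy
  rw [real_inner_smul_left]
  exact mul_nonpos_of_nonneg_of_nonpos hc (hw y hy)

/-- The residual of a projection onto a cone lies in its polar cone and is orthogonal to the
projection. -/
theorem sub_metricProj_of_cone {E : Type*} [NormedAddCommGroup E] [InnerProductSpace ℝ E]
    [CompleteSpace E] {K : Set E} (hne : K.Nonempty) (hcl : IsClosed K) (hconv : Convex ℝ K)
    (hcone : ∀ c : ℝ, 0 ≤ c → ∀ x ∈ K, c • x ∈ K) (x : E) :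
    x - metricProj K x ∈ polarCone K ∧ ⟪x - metricProj K x, metricProj K x⟫ = 0 := by
  obtain ⟨hmem, hvar⟩ := metricProj_spec hne hcl hconv x
  have h0 := hvar _ (hcone 0 le_rfl _ hmem)
  have h2 := hvar _ (hcone 2 zero_le_two _ hmem)
  rw [inner_sub_right, real_inner_smul_right] at h0 h2
  have horth : ⟪x - metricProj K x, metricProj K x⟫ = 0 := by linarith
  refine ⟨fun y hy => ?_, horth⟩
  have h := hvar y hy
  rw [inner_sub_right] at h
  linarith

/-- Bipolar theorem: a point making a nonpositive inner product with the whole polar cone of a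
closed convex cone belongs to the cone. -/
theorem mem_of_forall_polarCone {E : Type*} [NormedAddCommGroup E] [InnerProductSpace ℝ E]
    [CompleteSpace E] {K : Set E} (hne : K.Nonempty) (hcl : IsClosed K) (hconv : Convex ℝ K)
    (hcone : ∀ c : ℝ, 0 ≤ c → ∀ x ∈ K, c • x ∈ K) {p : E}
    (hp : ∀ w ∈ polarCone K, ⟪p, w⟫ ≤ 0) : p ∈ K := by
  obtain ⟨hpol, horth⟩ := sub_metricProj_of_cone hne hcl hconv hcone p
  have hle := hp _ hpol
  have hself : ⟪p - metricProj K p, p - metricProj K p⟫ ≤ 0 := by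
    rw [inner_sub_right, horth, real_inner_comm, sub_zero]
    exact hle
  rw [real_inner_self_nonpos, sub_eq_zero] at hself
  rw [hself]
  exact (metricProj_spec hne hcl hconv p).1

/-- One projected step on the dual variable, with the distance to the cone as a bonus term. -/
theorem dual_step_inequality {E : Type*} [NormedAddCommGroup E] [InnerProductSpace ℝ E]
    [CompleteSpace E] {K : Set E} (hne : K.Nonempty) (hcl : IsClosed K) (hconv : Convex ℝ K)
    (hcone : ∀ c : ℝ, 0 ≤ c → ∀ x ∈ K, c • x ∈ K) {β : ℝ} (hβ : 0 < β) (v y : E)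
    {w : E} (hw : w ∈ polarCone K) :
    β * coneDist K y + ⟪y, w - metricProj (polarCone K) (v + β • y)⟫
        + 1 / (2 * β) * ‖w - metricProj (polarCone K) (v + β • y)‖ ^ 2
      ≤ 1 / (2 * β) * ‖v - w‖ ^ 2 := by
  obtain ⟨hres, horth⟩ := sub_metricProj_of_cone ⟨0, zero_mem_polarCone K⟩
    (isClosed_polarCone K) (convex_polarCone K) (fun c hc x hx => smul_mem_polarCone hc hx)
    (v + β • y)
  set q := metricProj (polarCone K) (v + β • y)
  set p := v + β • y - q with hpdef
  have hpK : p ∈ K := mem_of_forall_polarCone hne hcl hconv hcone hres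
  have hinf : Metric.infDist y K ≤ ‖y - β⁻¹ • p‖ := by
    rw [← dist_eq_norm]
    exact Metric.infDist_le_dist_of_mem (hcone _ (inv_nonneg.2 hβ.le) _ hpK)
  have hdiff : v - q = -(β • (y - β⁻¹ • p)) := by
    rw [smul_sub, smul_inv_smul₀ hβ.ne', hpdef]
    abel
  have hsq : (β * Metric.infDist y K) ^ 2 ≤ ‖v - q‖ ^ 2 := by
    rw [hdiff, norm_neg, norm_smul, Real.norm_of_nonneg hβ.le]
    gcongr
    exact mul_nonneg hβ.le Metric.infDist_nonneg
  have hexp : ‖v - w‖ ^ 2 = ‖v - q‖ ^ 2 - 2 * ⟪v - q, w - q⟫ + ‖w - q‖ ^ 2 := by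
    rw [← norm_sub_sq_real, sub_sub_sub_cancel_right]
  have hvq : v - q = p - β • y := by rw [hpdef]; abel
  have hinner : ⟪v - q, w - q⟫ = ⟪p, w⟫ - β * ⟪y, w - q⟫ := by
    rw [hvq, inner_sub_left, real_inner_smul_left, inner_sub_right p, horth, sub_zero]
  have hpw : ⟪p, w⟫ ≤ 0 := hres w hw
  have key : (β * Metric.infDist y K) ^ 2 + 2 * β * ⟪y, w - q⟫ + ‖w - q‖ ^ 2 ≤ ‖v - w‖ ^ 2 := by
    rw [hexp, hinner]
    linarith
  calc _ = 1 / (2 * β) *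
        ((β * Metric.infDist y K) ^ 2 + 2 * β * ⟪y, w - q⟫ + ‖w - q‖ ^ 2) := by
        unfold coneDist
        field_simp
    _ ≤ _ := by gcongr

/-- Lemma 1 (one-step inequality for PIPG). -/
theorem pipg_one_step_inequality {n m : ℕ}
    (f : EuclideanSpace ℝ (Fin n) → ℝ) (μ lam : ℝ)
    (hf : ContDiff ℝ 1 f) (hμ : 0 ≤ μ) (hμlam : μ ≤ lam)
    (hstrong : ∀ x y : EuclideanSpace ℝ (Fin n),
      μ/2 * ‖x - y‖^2 ≤ f x - f y - ⟪gradient f y, x - y⟫)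
    (hsmooth : ∀ x y : EuclideanSpace ℝ (Fin n),
      f x - f y - ⟪gradient f y, x - y⟫ ≤ lam/2 * ‖x - y‖^2)
    (D : Set (EuclideanSpace ℝ (Fin n)))
    (hDne : D.Nonempty) (hDcl : IsClosed D) (hDconv : Convex ℝ D)
    (K : Set (EuclideanSpace ℝ (Fin m)))
    (hKne : K.Nonempty) (hKcl : IsClosed K) (hKconv : Convex ℝ K)
    (hKcone : ∀ c : ℝ, 0 ≤ c → ∀ x ∈ K, c • x ∈ K)
    (H : EuclideanSpace ℝ (Fin n) →L[ℝ] EuclideanSpace ℝ (Fin m))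
    (g : EuclideanSpace ℝ (Fin m))
    (σ α β : ℝ) (hσ : ‖H‖^2 ≤ σ) (hα : 0 < α) (hβ : 0 < β)
    (hstep : α * (lam + σ * β) = 1)
    (z0 : EuclideanSpace ℝ (Fin n)) (v0 : EuclideanSpace ℝ (Fin m)) (hz0 : z0 ∈ D)
    (wp : EuclideanSpace ℝ (Fin m)) (zp : EuclideanSpace ℝ (Fin n))
    (vp : EuclideanSpace ℝ (Fin m))
    (hwp : wp = metricProj (polarCone K) (v0 + β • (H z0 - g)))
    (hzp : zp = metricProj D (z0 - α • (gradient f z0 + (ContinuousLinearMap.adjoint H) wp)))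
    (hvp : vp = wp + β • (H (zp - z0))) :
    ∀ z ∈ D, ∀ w ∈ polarCone K,
      β * coneDist K (H z0 - g)
        + ((f zp + ⟪H zp - g, w⟫) - (f z + ⟪H z - g, wp⟫))
      ≤ (1/(2*α) - μ/2) * ‖z0 - z‖^2 + (1/(2*β)) * ‖v0 - w‖^2
        - (1/(2*α)) * ‖zp - z‖^2 - (1/(2*β)) * ‖vp - w‖^2 := by
  intro z hz w hw
  have hdual := dual_step_inequality hKne hKcl hKconv hKcone hβ v0 (H z0 - g) hw
  rw [← hwp] at hdual
  have hvar := (metricProj_spec hDne hDcl hDconv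
    (z0 - α • (gradient f z0 + (ContinuousLinearMap.adjoint H) wp))).2 z hz
  rw [← hzp] at hvar
  have hlow := hstrong z z0
  have hup := hsmooth zp z0
  have hvar' : ⟪z0 - zp, z - zp⟫ - α * (⟪gradient f z0, z - zp⟫ + ⟪H (z - zp), wp⟫) ≤ 0 := by
    rw [sub_right_comm, inner_sub_left, real_inner_smul_left, inner_add_left,
      ContinuousLinearMap.adjoint_inner_left, real_inner_comm (H (z - zp)) wp] at hvar
    exact hvar
  have hprimal : ⟪gradient f z0, zp - z⟫ + ⟪H (zp - z), wp⟫
      ≤ 1 / (2 * α) * (‖z0 - z‖ ^ 2 - ‖zp - z‖ ^ 2 - ‖zp - z0‖ ^ 2) := by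
    have hexp : ‖z0 - z‖ ^ 2 = ‖z0 - zp‖ ^ 2 - 2 * ⟪z0 - zp, z - zp⟫ + ‖z - zp‖ ^ 2 := by
      rw [← norm_sub_sq_real, sub_sub_sub_cancel_right]
    rw [hexp, norm_sub_rev zp z, norm_sub_rev zp z0, ← neg_sub z zp, map_neg, inner_neg_left,
      inner_neg_right, one_div, le_inv_mul_iff₀ (by positivity)]
    linarith
  have hdualExp : ⟪H (zp - z0), w - wp⟫ = 1 / (2 * β) *
      (β ^ 2 * ‖H (zp - z0)‖ ^ 2 + ‖w - wp‖ ^ 2 - ‖vp - w‖ ^ 2) := by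
    have hvw : vp - w = β • H (zp - z0) - (w - wp) := by rw [hvp]; abel
    rw [hvw, norm_sub_sq_real (β • _), norm_smul, real_inner_smul_left, Real.norm_of_nonneg hβ.le]
    field_simp
    ring
  have hH : ‖H (zp - z0)‖ ^ 2 ≤ σ * ‖zp - z0‖ ^ 2 := by
    calc ‖H (zp - z0)‖ ^ 2 ≤ (‖H‖ * ‖zp - z0‖) ^ 2 := by gcongr; exact H.le_opNorm _
      _ = ‖H‖ ^ 2 * ‖zp - z0‖ ^ 2 := mul_pow ..
      _ ≤ _ := by gcongr
  have hβH : 1 / (2 * β) * (β ^ 2 * ‖H (zp - z0)‖ ^ 2) ≤ σ * β / 2 * ‖zp - z0‖ ^ 2 := by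
    calc _ = β / 2 * ‖H (zp - z0)‖ ^ 2 := by field_simp
      _ ≤ β / 2 * (σ * ‖zp - z0‖ ^ 2) := by gcongr
      _ = _ := by ring
  have hα' : 1 / (2 * α) = (lam + σ * β) / 2 := by
    field_simp
    linarith
  have hgrad : ⟪gradient f z0, zp - z⟫ =
      ⟪gradient f z0, zp - z0⟫ - ⟪gradient f z0, z - z0⟫ := by
    rw [← inner_sub_right, sub_sub_sub_cancel_right]
  have hlag : ⟪H zp - g, w⟫ - ⟪H z - g, wp⟫ =
      ⟪H (zp - z), wp⟫ + ⟪H z0 - g, w - wp⟫ + ⟪H (zp - z0), w - wp⟫ := by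
    simp only [map_sub, inner_sub_left, inner_sub_right]
    ring
  rw [norm_sub_rev z z0] at hlow
  rw [hα'] at hprimal ⊢
  linarith
end

section
/- Let K ⊆ ℝ^m be a nonempty closed convex cone with polar cone K°, let x, v ∈ ℝ^m and β > 0, and set w = π_{K°}[v + βx]. Then d_K(x) ≤ (1/(2β²))‖w − v‖². -/
open RealInnerProductSpace

/-- **Moreau decomposition**: every point splits as the sum of a point of a closed convex cone and
an orthogonal point of its polar cone. -/
theorem exists_mem_sub_mem_polarCone {E : Type*} [NormedAddCommGroup E] [InnerProductSpace ℝ E]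
    [CompleteSpace E] {K : Set E} (hne : K.Nonempty) (hcl : IsClosed K) (hconv : Convex ℝ K)
    (hcone : ∀ c : ℝ, 0 ≤ c → ∀ x ∈ K, c • x ∈ K) (z : E) :
    ∃ p ∈ K, z - p ∈ polarCone K ∧ ⟪z - p, p⟫ = 0 := by
  obtain ⟨p, hp, hmin⟩ := exists_norm_eq_iInf_of_complete_convex hne hcl.isComplete hconv z
  have hvar := (norm_eq_iInf_iff_real_inner_le_zero hconv hp).1 hmin
  have horth : ⟪z - p, p⟫ = 0 := by
    have h0 := hvar _ (hcone 0 le_rfl p hp)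
    have h2 := hvar _ (hcone 2 zero_le_two p hp)
    rw [inner_sub_right, real_inner_smul_right] at h0 h2
    linarith
  refine ⟨p, hp, fun y hy => ?_, horth⟩
  have := hvar y hy
  rwa [inner_sub_right, horth, sub_zero] at this

/-- If `p ∈ K` and `z - p` is a point of the polar cone orthogonal to `p`, then `z - p` is the
projection of `z` onto the polar cone. -/
theorem metricProj_polarCone_eq_sub {E : Type*} [NormedAddCommGroup E] [InnerProductSpace ℝ E]
    {K : Set E} {z p : E} (hp : p ∈ K) (hq : z - p ∈ polarCone K) (horth : ⟪z - p, p⟫ = 0) :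
    metricProj (polarCone K) z = z - p := by
  have hpyth : ∀ u ∈ polarCone K, ‖p‖ ^ 2 + ‖z - p - u‖ ^ 2 ≤ ‖z - u‖ ^ 2 := by
    intro u hu
    have hup : ⟪u, p⟫ ≤ 0 := hu p hp
    have h := norm_add_sq_real (z - p - u) p
    rw [inner_sub_left, horth, show z - p - u + p = z - u by abel] at h
    linarith
  have hex : ∃ y, y ∈ polarCone K ∧ ∀ u ∈ polarCone K, ‖z - y‖ ≤ ‖z - u‖ := by
    refine ⟨z - p, hq, fun u hu => ?_⟩
    rw [sub_sub_cancel]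
    refine (sq_le_sq₀ (norm_nonneg _) (norm_nonneg _)).1 ?_
    linarith [hpyth u hu, sq_nonneg ‖z - p - u‖]
  rw [metricProj, dif_pos hex]
  obtain ⟨hmem, hmin⟩ := hex.choose_spec
  have hle := hmin _ hq
  rw [sub_sub_cancel] at hle
  have hle2 := pow_le_pow_left₀ (norm_nonneg _) hle 2
  have hzero : ‖z - p - hex.choose‖ ^ 2 = 0 :=
    le_antisymm (by linarith [hpyth _ hmem]) (sq_nonneg _)
  exact (sub_eq_zero.1 (norm_eq_zero.1 (pow_eq_zero_iff two_ne_zero |>.1 hzero))).symm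

/-- Bound on the distance to the cone `K` via the polar-cone projection residual. -/
theorem coneDist_le_of_polar_proj {m : ℕ}
    (K : Set (EuclideanSpace ℝ (Fin m)))
    (hKne : K.Nonempty) (hKcl : IsClosed K) (hKconv : Convex ℝ K)
    (hKcone : ∀ c : ℝ, 0 ≤ c → ∀ x ∈ K, c • x ∈ K)
    (x v : EuclideanSpace ℝ (Fin m)) (β : ℝ) (hβ : 0 < β)
    (w : EuclideanSpace ℝ (Fin m))
    (hw : w = metricProj (polarCone K) (v + β • x)) :
    coneDist K x ≤ (1/(2*β^2)) * ‖w - v‖^2 := by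
  obtain ⟨p, hp, hq, horth⟩ :=
    exists_mem_sub_mem_polarCone hKne hKcl hKconv hKcone (v + β • x)
  rw [metricProj_polarCone_eq_sub hp hq horth] at hw
  have hdist : Metric.infDist x K ≤ β⁻¹ * ‖w - v‖ := by
    have hwv : w - v = β • (x - β⁻¹ • p) := by
      rw [hw, smul_sub, smul_inv_smul₀ hβ.ne']
      abel
    rw [hwv, norm_smul, Real.norm_of_nonneg hβ.le, inv_mul_cancel_left₀ hβ.ne', ← dist_eq_norm]
    exact Metric.infDist_le_dist_of_mem (hKcone _ (inv_nonneg.2 hβ.le) p hp)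
  calc coneDist K x ≤ (1/2) * (β⁻¹ * ‖w - v‖) ^ 2 := by
        unfold coneDist
        gcongr
        exact Metric.infDist_nonneg
    _ = (1/(2*β^2)) * ‖w - v‖^2 := by
        field_simp
end

section
/- Let μ, λ, σ be real numbers with 0 < μ ≤ λ and σ > 0, and set κ = λ/μ. For each integer j ≥ 0 define α^j = 2/((j+1)μ + 2λ) and β^j = (j+1)μ/(2σ). Then for every integer j ≥ 1 the following hold: (1/α^j − μ)(j + 2κ) = (1/α^{j−1})(j + 2κ − 1), and (1/β^j)(j + 2κ) ≤ (1/β^{j−1})(j + 2κ − 1). -/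
/-- Step-size identities/inequality for the varying step sizes of PIPG in the strongly
convex case. -/
theorem pipg_step_size_relations (μ lam σ κ : ℝ)
    (hμ : 0 < μ) (hμlam : μ ≤ lam) (hσ : 0 < σ) (hκ : κ = lam/μ)
    (α β : ℕ → ℝ)
    (hα : ∀ j : ℕ, α j = 2/(((j:ℝ)+1)*μ + 2*lam))
    (hβ : ∀ j : ℕ, β j = ((j:ℝ)+1)*μ/(2*σ)) :
    ∀ j : ℕ, 1 ≤ j →
      (1/(α j) - μ) * ((j:ℝ) + 2*κ) = (1/(α (j-1))) * ((j:ℝ) + 2*κ - 1) ∧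
      (1/(β j)) * ((j:ℝ) + 2*κ) ≤ (1/(β (j-1))) * ((j:ℝ) + 2*κ - 1) := by
  intro j hj
  obtain ⟨n, rfl⟩ := Nat.exists_eq_add_of_le' hj
  have hlam : lam = κ * μ := by rw [hκ, div_mul_cancel₀ _ hμ.ne']
  have hκ1 : 1 ≤ κ := by rwa [hκ, one_le_div hμ]
  have hn : (0 : ℝ) ≤ n := n.cast_nonneg
  rw [Nat.add_sub_cancel, hα, hα, hβ, hβ, hlam]
  push_cast
  simp only [one_div_div]
  constructor
  · ring
  · rw [div_mul_eq_mul_div, div_mul_eq_mul_div, div_le_div_iff₀ (by positivity) (by positivity)]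
    have h : 0 ≤ 2 * σ * μ * (2 * κ - 1) := mul_nonneg (by positivity) (by linarith)
    linarith
end
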